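/- arXiv:1605.08391 — 4 statements merged into one kernel-verified Lean document; each statement's English description precedes it below -/
import Mathlib

section
/- For any random variable Z : Ω → ℝ, any risk weight ρ with 0 ≤ ρ ≤ 1, and any target η ∈ ℝ with η ≤ E[Z], the sandwich relation holds: E[Z] ≤ (1 − ρ)·E[Z] + ρ·η + ρ·EE_η(Z) ≤ E[Z] + ρ·ASD(Z); moreover, if η = E[Z] then the upper bound is attained with equality: (1 − ρ)·E[Z] + ρ·η + ρ·EE_η(Z) = E[Z] + ρ·ASD(Z). -/
open Finset

noncomputable def expect {Ω : Type*} [Fintype Ω] (p Z : Ω → ℝ) : ℝ :=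
  ∑ ω, p ω * Z ω

noncomputable def ASD {Ω : Type*} [Fintype Ω] (p Z : Ω → ℝ) : ℝ :=
  ∑ ω, p ω * max (Z ω - expect p Z) 0

noncomputable def EE {Ω : Type*} [Fintype Ω] (p Z : Ω → ℝ) (η : ℝ) : ℝ :=
  ∑ ω, p ω * max (Z ω - η) 0

theorem expect_le_add_EE {Ω : Type*} [Fintype Ω] {p : Ω → ℝ} (hp : ∀ ω, 0 ≤ p ω)
    (hps : ∑ ω, p ω = 1) (Z : Ω → ℝ) (η : ℝ) : expect p Z ≤ η + EE p Z η := by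
  calc expect p Z ≤ ∑ ω, (p ω * η + p ω * max (Z ω - η) 0) := by
        refine Finset.sum_le_sum fun ω _ => ?_
        rw [← mul_add]
        exact mul_le_mul_of_nonneg_left (by linarith [le_max_left (Z ω - η) 0]) (hp ω)
    _ = η + EE p Z η := by rw [Finset.sum_add_distrib, ← Finset.sum_mul, hps, one_mul, EE]

/-- The map `η ↦ η + EE p Z η` is monotone. -/
theorem add_EE_mono {Ω : Type*} [Fintype Ω] {p : Ω → ℝ} (hp : ∀ ω, 0 ≤ p ω)
    (hps : ∑ ω, p ω = 1) (Z : Ω → ℝ) : Monotone fun η => η + EE p Z η := by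
  intro η η' h
  have key : EE p Z η ≤ (η' - η) + EE p Z η' := by
    calc EE p Z η ≤ ∑ ω, (p ω * (η' - η) + p ω * max (Z ω - η') 0) := by
          refine Finset.sum_le_sum fun ω _ => ?_
          rw [← mul_add]
          refine mul_le_mul_of_nonneg_left (max_le ?_ ?_) (hp ω)
          · linarith [le_max_left (Z ω - η') 0]
          · linarith [le_max_right (Z ω - η') 0]
      _ = (η' - η) + EE p Z η' := by
          rw [Finset.sum_add_distrib, ← Finset.sum_mul, hps, one_mul, EE]
  show η + EE p Z η ≤ η' + EE p Z η'
  linarith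

theorem EE_expect {Ω : Type*} [Fintype Ω] (p Z : Ω → ℝ) : EE p Z (expect p Z) = ASD p Z := rfl

theorem sandwich_relation {Ω : Type*} [Fintype Ω] [Nonempty Ω]
    (p : Ω → ℝ) (hp : ∀ ω, 0 ≤ p ω) (hps : ∑ ω, p ω = 1)
    (Z : Ω → ℝ) (ρ : ℝ) (hρ0 : 0 ≤ ρ) (hρ1 : ρ ≤ 1)
    (η : ℝ) (hη : η ≤ expect p Z) :
    expect p Z ≤ (1 - ρ) * expect p Z + ρ * η + ρ * EE p Z η ∧
    (1 - ρ) * expect p Z + ρ * η + ρ * EE p Z η ≤ expect p Z + ρ * ASD p Z ∧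
    (η = expect p Z →
      (1 - ρ) * expect p Z + ρ * η + ρ * EE p Z η = expect p Z + ρ * ASD p Z) := by
  have lower := mul_le_mul_of_nonneg_left (expect_le_add_EE hp hps Z η) hρ0
  have upper : ρ * (η + EE p Z η) ≤ ρ * (expect p Z + ASD p Z) :=
    mul_le_mul_of_nonneg_left (add_EE_mono hp hps Z hη) hρ0
  refine ⟨by linarith, by linarith, ?_⟩
  rintro rfl
  rw [EE_expect]
  ring
end

section
/- For any random variable Z : Ω → ℝ and any risk weight ρ with 0 ≤ ρ ≤ 1, the function v* : Ω → ℝ defined by v*(ω) = max(Z(ω), E[Z]) satisfies the constraints v*(ω) ≥ Z(ω) and v*(ω) ≥ E[Z] for all ω ∈ Ω, and attains the mean-risk value exactly: (1 − ρ)·E[Z] + ρ·Σ_{ω∈Ω} p(ω)·v*(ω) = E[Z] + ρ·ASD(Z). -/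
open Finset

theorem sum_mul_max_eq_add_sum_mul_max_sub {Ω : Type*} [Fintype Ω] (p Z : Ω → ℝ)
    (hps : ∑ ω, p ω = 1) (c : ℝ) :
    ∑ ω, p ω * max (Z ω) c = c + ∑ ω, p ω * max (Z ω - c) 0 := by
  have h (ω : Ω) : p ω * max (Z ω) c = p ω * c + p ω * max (Z ω - c) 0 := by
    rw [← mul_add, add_comm c, max_add, sub_add_cancel, zero_add]
  simp_rw [h, sum_add_distrib, ← sum_mul, hps, one_mul]

theorem epigraph_optimal_attains_mean_risk {Ω : Type*} [Fintype Ω] [Nonempty Ω]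
    (p : Ω → ℝ) (hp : ∀ ω, 0 ≤ p ω) (hps : ∑ ω, p ω = 1)
    (Z : Ω → ℝ) (ρ : ℝ) (hρ0 : 0 ≤ ρ) (hρ1 : ρ ≤ 1) :
    (∀ ω, Z ω ≤ max (Z ω) (expect p Z)) ∧
    (∀ ω, expect p Z ≤ max (Z ω) (expect p Z)) ∧
    (1 - ρ) * expect p Z + ρ * ∑ ω, p ω * max (Z ω) (expect p Z)
      = expect p Z + ρ * ASD p Z := by
  refine ⟨fun _ => le_max_left _ _, fun _ => le_max_right _ _, ?_⟩
  rw [sum_mul_max_eq_add_sum_mul_max_sub p Z hps, ASD]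
  ring
end

section
/- For any random variables X, Y : Ω → ℝ with X(ω) ≤ Y(ω) for all ω ∈ Ω and any risk weight ρ with 0 ≤ ρ ≤ 1, the mean–absolute-semi-deviation functional is monotone: E[X] + ρ·ASD(X) ≤ E[Y] + ρ·ASD(Y). -/
open Finset

lemma expect_mono {Ω : Type*} [Fintype Ω] {p X Y : Ω → ℝ} (hp : ∀ ω, 0 ≤ p ω)
    (hXY : ∀ ω, X ω ≤ Y ω) : expect p X ≤ expect p Y :=
  Finset.sum_le_sum fun ω _ => mul_le_mul_of_nonneg_left (hXY ω) (hp ω)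

lemma expect_add_ASD {Ω : Type*} [Fintype Ω] {p : Ω → ℝ} (hps : ∑ ω, p ω = 1) (Z : Ω → ℝ) :
    expect p Z + ASD p Z = expect p fun ω => max (Z ω) (expect p Z) := by
  have hmax (ω : Ω) : max (Z ω) (expect p Z) = expect p Z + max (Z ω - expect p Z) 0 := by
    rw [← max_add_add_left, add_sub_cancel, add_zero]
  conv_rhs => rw [_root_.expect]
  simp only [hmax, mul_add, Finset.sum_add_distrib, ← Finset.sum_mul, hps, one_mul, ASD]

theorem mean_asd_monotone {Ω : Type*} [Fintype Ω] [Nonempty Ω]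
    (p : Ω → ℝ) (hp : ∀ ω, 0 ≤ p ω) (hps : ∑ ω, p ω = 1)
    (X Y : Ω → ℝ) (hXY : ∀ ω, X ω ≤ Y ω)
    (ρ : ℝ) (hρ0 : 0 ≤ ρ) (hρ1 : ρ ≤ 1) :
    expect p X + ρ * ASD p X ≤ expect p Y + ρ * ASD p Y := by
  have hE : expect p X ≤ expect p Y := expect_mono hp hXY
  have hA : expect p X + ASD p X ≤ expect p Y + ASD p Y := by
    rw [expect_add_ASD hps, expect_add_ASD hps]
    exact expect_mono hp fun ω => max_le_max (hXY ω) hE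
  calc expect p X + ρ * ASD p X
      = (1 - ρ) * expect p X + ρ * (expect p X + ASD p X) := by ring
    _ ≤ (1 - ρ) * expect p Y + ρ * (expect p Y + ASD p Y) := by
        have : 0 ≤ 1 - ρ := sub_nonneg.mpr hρ1
        gcongr
    _ = expect p Y + ρ * ASD p Y := by ring
end

section
/- For any random variables X, Y : Ω → ℝ, any risk weight ρ with 0 ≤ ρ ≤ 1, and any λ with 0 ≤ λ ≤ 1, the mean–absolute-semi-deviation functional is convex: E[λ·X + (1 − λ)·Y] + ρ·ASD(λ·X + (1 − λ)·Y) ≤ λ·(E[X] + ρ·ASD(X)) + (1 − λ)·(E[Y] + ρ·ASD(Y)), where (λ·X + (1 − λ)·Y)(ω) = λ·X(ω) + (1 − λ)·Y(ω) for all ω ∈ Ω. -/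
open Finset

theorem expect_linear_comb {Ω : Type*} [Fintype Ω] (p X Y : Ω → ℝ) (a b : ℝ) :
    expect p (fun ω => a * X ω + b * Y ω) = a * expect p X + b * expect p Y := by
  simp only [_root_.expect, mul_sum, ← sum_add_distrib]
  exact sum_congr rfl fun ω _ => by ring

theorem ASD_linear_comb_le {Ω : Type*} [Fintype Ω] {p : Ω → ℝ} (hp : ∀ ω, 0 ≤ p ω)
    (X Y : Ω → ℝ) {a b : ℝ} (ha : 0 ≤ a) (hb : 0 ≤ b) :
    ASD p (fun ω => a * X ω + b * Y ω) ≤ a * ASD p X + b * ASD p Y := by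
  simp only [ASD, expect_linear_comb, mul_sum, ← sum_add_distrib]
  refine sum_le_sum fun ω _ => ?_
  have h : max (a * X ω + b * Y ω - (a * expect p X + b * expect p Y)) 0
      ≤ a * max (X ω - expect p X) 0 + b * max (Y ω - expect p Y) 0 := by
    refine max_le ?_ (by positivity)
    have hX := mul_le_mul_of_nonneg_left (le_max_left (X ω - expect p X) 0) ha
    have hY := mul_le_mul_of_nonneg_left (le_max_left (Y ω - expect p Y) 0) hb
    linarith
  calc _ ≤ _ := mul_le_mul_of_nonneg_left h (hp ω)
    _ = _ := by ring

theorem mean_asd_convex {Ω : Type*} [Fintype Ω] [Nonempty Ω]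
    (p : Ω → ℝ) (hp : ∀ ω, 0 ≤ p ω) (hps : ∑ ω, p ω = 1)
    (X Y : Ω → ℝ) (ρ : ℝ) (hρ0 : 0 ≤ ρ) (hρ1 : ρ ≤ 1)
    (l : ℝ) (hl0 : 0 ≤ l) (hl1 : l ≤ 1) :
    expect p (fun ω => l * X ω + (1 - l) * Y ω)
      + ρ * ASD p (fun ω => l * X ω + (1 - l) * Y ω)
      ≤ l * (expect p X + ρ * ASD p X) + (1 - l) * (expect p Y + ρ * ASD p Y) := by
  rw [expect_linear_comb]
  have h := mul_le_mul_of_nonneg_left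
    (ASD_linear_comb_le hp X Y hl0 (sub_nonneg.mpr hl1)) hρ0
  linarith
end
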